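/- Every temporal spanner of G_φ contains both edges BT and BF in its footprint. -/

import Mathlib

namespace TemporalPaper

/-- A temporal graph on vertex set `V`: an undirected labeling assigning to each
(unordered) pair of vertices a finite set of rational time labels; a pair is an
edge of the graph iff its label set is nonempty. -/
structure TemporalGraph (V : Type*) where
  label : V → V → Finset ℚ
  symm : ∀ u v, label u v = label v u
  loopless : ∀ v, label v v = ∅

namespace TemporalGraph

variable {V : Type*}

/-- The footprint (static underlying graph) of a temporal graph. -/
def footprint (G : TemporalGraph V) : SimpleGraph V where
  Adj u v := (G.label u v).Nonempty
  symm := ⟨fun u v h => by rwa [G.symm]⟩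
  loopless := ⟨fun v h => by rw [G.loopless] at h; exact Finset.not_nonempty_empty h⟩

/-- The snapshot of a temporal graph at time `t`. -/
def snapshot (G : TemporalGraph V) (t : ℚ) : SimpleGraph V where
  Adj u v := t ∈ G.label u v
  symm := ⟨fun u v h => by rwa [G.symm]⟩
  loopless := ⟨fun v h => by rw [G.loopless] at h; exact absurd h (Finset.notMem_empty t)⟩

/-- `G.IsTJ r p ts` : the list of vertices `p` together with the list of times `ts`
(one per consecutive pair of vertices of `p`) forms a temporal walk, i.e. each time
belongs to the labels of the corresponding edge, and consecutive times satisfy `r`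
(`r = (· ≤ ·)` for non-strict temporal walks, `r = (· < ·)` for strict ones). -/
inductive IsTJ (G : TemporalGraph V) (r : ℚ → ℚ → Prop) : List V → List ℚ → Prop
  | single (v : V) : IsTJ G r [v] []
  | cons {u v : V} {p : List V} {t : ℚ} {ts : List ℚ} :
      t ∈ G.label u v → IsTJ G r (v :: p) ts →
      (∀ t' ∈ ts.head?, r t t') → IsTJ G r (u :: v :: p) (t :: ts)

/-- A temporal path from `u` to `v` with underlying (vertex-)path `p` and times `ts`. -/
def TPath (G : TemporalGraph V) (r : ℚ → ℚ → Prop) (u v : V)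
    (p : List V) (ts : List ℚ) : Prop :=
  G.IsTJ r p ts ∧ p.Nodup ∧ p.head? = some u ∧ p.getLast? = some v

/-- Temporal reachability. -/
def Reach (G : TemporalGraph V) (r : ℚ → ℚ → Prop) (u v : V) : Prop :=
  ∃ p ts, G.TPath r u v p ts

def TemporallyConnectedRel (G : TemporalGraph V) (r : ℚ → ℚ → Prop) : Prop :=
  ∀ u v : V, u ≠ v → G.Reach r u v

/-- Temporal connectivity (non-strict setting). -/
def TemporallyConnected (G : TemporalGraph V) : Prop :=
  G.TemporallyConnectedRel (· ≤ ·)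

/-- A bidirectional temporal path (bi-path) between `u` and `v` on the underlying
path `p` (from `u` to `v`): a temporal path in each direction along `p`. -/
def BiPath (G : TemporalGraph V) (r : ℚ → ℚ → Prop) (u v : V)
    (p : List V) (ts₁ ts₂ : List ℚ) : Prop :=
  G.TPath r u v p ts₁ ∧ G.TPath r v u p.reverse ts₂

def BiConnectedRel (G : TemporalGraph V) (r : ℚ → ℚ → Prop) : Prop :=
  ∀ u v : V, u ≠ v → ∃ p ts₁ ts₂, G.BiPath r u v p ts₁ ts₂

/-- Bidirectional temporal connectivity (non-strict setting). -/
def BiConnected (G : TemporalGraph V) : Prop := G.BiConnectedRel (· ≤ ·)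

/-- `H` is a temporal subgraph of `G` (on the same vertex set). -/
def IsSubgraph (H G : TemporalGraph V) : Prop := ∀ u v, H.label u v ⊆ G.label u v

/-- A temporal spanner of `G`: a temporally connected temporal subgraph on all of `V`. -/
def IsSpanner (H G : TemporalGraph V) : Prop := H.IsSubgraph G ∧ H.TemporallyConnected

/-- A temporal spanning tree of `G`: a temporal spanner whose footprint is a tree. -/
def IsSpanningTree (H G : TemporalGraph V) : Prop := H.IsSpanner G ∧ H.footprint.IsTree

/-- A bidirectional temporal spanner (bi-spanner) of `G`. -/
def IsBiSpanner (H G : TemporalGraph V) : Prop := H.IsSpanner G ∧ H.BiConnected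

/-- A temporal graph is simple if every edge has exactly one time label,
i.e. every label set has at most one element (edges have nonempty label sets). -/
def Simple (G : TemporalGraph V) : Prop := ∀ u v, (G.label u v).card ≤ 1

/-- A temporal graph is proper if any two (distinct) edges sharing a vertex have
disjoint label sets. -/
def Proper (G : TemporalGraph V) : Prop :=
  ∀ u v w : V, v ≠ w → Disjoint (G.label u v) (G.label u w)

def Happy (G : TemporalGraph V) : Prop := G.Simple ∧ G.Proper

/-- `u` can reach `v` by a (non-strict) temporal path arriving at time at most `t`. -/
def ArrivesBy (G : TemporalGraph V) (u v : V) (t : ℚ) : Prop :=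
  ∃ p ts, G.TPath (· ≤ ·) u v p ts ∧ ∀ t' ∈ ts.getLast?, t' ≤ t

/-- `u` can reach `v` by a (non-strict) temporal path departing at time at least `t`. -/
def DepartsAfter (G : TemporalGraph V) (u v : V) (t : ℚ) : Prop :=
  ∃ p ts, G.TPath (· ≤ ·) u v p ts ∧ ∀ t' ∈ ts.head?, t ≤ t'

/-- A pivot: some time `t` such that every other vertex reaches `x` by time `t`
and `x` reaches every other vertex departing not earlier than `t`. -/
def IsPivot (G : TemporalGraph V) (x : V) : Prop :=
  ∃ t : ℚ, ∀ u : V, u ≠ x → G.ArrivesBy u x t ∧ G.DepartsAfter x u t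

/-- Deleting the (undirected) edge `ab` from a temporal graph. -/
def deleteEdge [DecidableEq V] (G : TemporalGraph V) (a b : V) : TemporalGraph V where
  label u v := if (u = a ∧ v = b) ∨ (u = b ∧ v = a) then ∅ else G.label u v
  symm := by
    intro u v
    have h : ((u = a ∧ v = b) ∨ (u = b ∧ v = a)) ↔ ((v = a ∧ u = b) ∨ (v = b ∧ u = a)) := by
      tauto
    rw [G.symm, if_congr h rfl rfl]
  loopless := by
    intro v
    split_ifs with h
    · rfl
    · exact G.loopless v

end TemporalGraph

end TemporalPaper

namespace TemporalPaper

open TemporalGraph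

/-- Vertices of the temporal graph `G_φ` built from a CNF formula `φ` with `n`
variables and `k` clauses: one vertex per variable, one per clause, and three special
vertices `T`, `F`, `B`. -/
inductive Vphi (n k : ℕ) : Type
  | var : Fin n → Vphi n k
  | cls : Fin k → Vphi n k
  | T : Vphi n k
  | F : Vphi n k
  | B : Vphi n k
deriving DecidableEq

/-- The reference time `t⁺ = n + k + 1`. -/
def tpos (n k : ℕ) : ℚ := n + k + 1

/-- The reference time `t⁻ = -t⁺`. -/
def tneg (n k : ℕ) : ℚ := -(tpos n k)

/-- The value `ε`, a fixed rational with `0 < ε < 1`. -/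
def eps : ℚ := 1/2

/-- One orientation of the labeling of `G_φ`. The formula `φ` is encoded by
`φ j i = some true` if variable `x_i` occurs positively in clause `c_j`,
`φ j i = some false` if it occurs negatively, and `φ j i = none` if it does not occur
(so no clause contains both a variable and its negation). Variable and clause indices
are taken `1`-based (`i+1`, `j+1`) as in the paper. -/
def corePhi (n k : ℕ) (φ : Fin k → Fin n → Option Bool) :
    Vphi n k → Vphi n k → Finset ℚ
  | .B, .T => {tneg n k, eps}
  | .B, .F => {-eps, tpos n k}
  | .T, .var i => {tneg n k - ((i : ℚ) + 1), (i : ℚ) + 1}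
  | .F, .var i => {-((i : ℚ) + 1), tpos n k + ((i : ℚ) + 1)}
  | .var i, .cls j =>
      match φ j i with
      | some true => {tneg n k - (((i : ℚ) + 1) + ((j : ℚ) + 1)),
                      ((i : ℚ) + 1) + ((j : ℚ) + 1)}
      | some false => {-(((i : ℚ) + 1) + ((j : ℚ) + 1)),
                       tpos n k + (((i : ℚ) + 1) + ((j : ℚ) + 1))}
      | none => ∅
  | _, _ => ∅

/-- The temporal graph `G_φ` of the reduction from SAT to TST. -/
def Gphi (n k : ℕ) (φ : Fin k → Fin n → Option Bool) : TemporalGraph (Vphi n k) where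
  label u v := corePhi n k φ u v ∪ corePhi n k φ v u
  symm := fun u v => Finset.union_comm _ _
  loopless := fun v => by cases v <;> rfl

/-- The edge `x_i c_j` is a positive edge of `G_φ`. -/
def PosEdge {n k : ℕ} (φ : Fin k → Fin n → Option Bool) (i : Fin n) (j : Fin k) : Prop :=
  φ j i = some true

/-- The edge `x_i c_j` is a negative edge of `G_φ`. -/
def NegEdge {n k : ℕ} (φ : Fin k → Fin n → Option Bool) (i : Fin n) (j : Fin k) : Prop :=
  φ j i = some false

/-- `φ` is satisfiable: some assignment makes a literal of every clause true. -/
def Satisfiable {n k : ℕ} (φ : Fin k → Fin n → Option Bool) : Prop :=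
  ∃ σ : Fin n → Bool, ∀ j : Fin k, ∃ i : Fin n, ∃ b : Bool, φ j i = some b ∧ σ i = b

end TemporalPaper

namespace TemporalPaper

namespace TemporalGraph

/-- A predicate on vertices and departure times that holds at `w` and is preserved backwards along
contacts holds at the start of every non-strict temporal walk ending in `w`. -/
theorem IsTJ.backward_invariant {V : Type*} {G : TemporalGraph V} {P : V → ℚ → Prop} {w : V}
    (hw : ∀ s, P w s)
    (hstep : ∀ u v s t, t ∈ G.label u v → P v t → s ≤ t → P u s)
    {p : List V} {ts : List ℚ} (h : G.IsTJ (· ≤ ·) p ts) (hlast : p.getLast? = some w) :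
    ∀ u ∈ p.head?, ∀ s, (∀ t ∈ ts.head?, s ≤ t) → P u s := by
  induction h with
  | single v =>
    intro u hu s _
    simp_all
  | @cons u v p t ts ht _ hr ih =>
    intro u' hu' s hs
    obtain rfl : u = u' := by simpa using hu'
    refine hstep u v s t ht (ih ?_ v (by simp) t hr) (hs t (by simp))
    simpa using hlast

theorem Reach.exists_of_backward_invariant {V : Type*} {G : TemporalGraph V}
    {P : V → ℚ → Prop} {u w : V} (h : G.Reach (· ≤ ·) u w) (hw : ∀ s, P w s)
    (hstep : ∀ u v s t, t ∈ G.label u v → P v t → s ≤ t → P u s) : ∃ s, P u s := by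
  obtain ⟨p, ts, hp, -, hhead, hlast⟩ := h
  refine ⟨ts.head?.getD 0, hp.backward_invariant hw hstep hlast u hhead _ ?_⟩
  intro t ht
  rw [Option.mem_def] at ht
  simp [ht]

end TemporalGraph

/-- Departure constraint satisfied by every walk to `T` that avoids the edge `BT`. -/
def BeforeT (n k : ℕ) : Vphi n k → ℚ → Prop
  | .T, _ => True
  | .B, _ => False
  | .F, s => s < -eps
  | .var _, s => s < tpos n k
  | .cls _, s => s < tpos n k

/-- Departure constraint satisfied by every walk to `B` that avoids the edge `BF`. -/
def BeforeB (n k : ℕ) : Vphi n k → ℚ → Prop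
  | .B, _ => True
  | .F, _ => False
  | .T, s => s ≤ eps
  | .var _, s => s ≤ tneg n k
  | .cls _, s => s ≤ tneg n k

theorem beforeT_of_contact {n k : ℕ} {φ : Fin k → Fin n → Option Bool} {u v : Vphi n k}
    {s t : ℚ} (hBT : ¬(u = .B ∧ v = .T)) (ht : t ∈ (Gphi n k φ).label u v)
    (hv : BeforeT n k v t) (hst : s ≤ t) : BeforeT n k u s := by
  cases u <;> cases v <;>
    simp [Gphi, corePhi, BeforeT, tpos, tneg, eps] at hBT ht hv ⊢ <;>
    have hn : (0 : ℚ) ≤ n := n.cast_nonneg <;>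
    have hk : (0 : ℚ) ≤ k := k.cast_nonneg <;>
    first
    | linarith
    | (rename_i i
       have h0 : (0 : ℚ) ≤ i := Nat.cast_nonneg _
       have h1 : (i : ℚ) + 1 ≤ n := by exact_mod_cast i.2
       rcases ht with rfl | rfl <;> linarith)
    | (rcases ht with rfl | rfl <;> linarith)

theorem beforeB_of_contact {n k : ℕ} {φ : Fin k → Fin n → Option Bool} {u v : Vphi n k}
    {s t : ℚ} (hFB : ¬(u = .F ∧ v = .B)) (ht : t ∈ (Gphi n k φ).label u v)
    (hv : BeforeB n k v t) (hst : s ≤ t) : BeforeB n k u s := by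
  cases u <;> cases v <;>
    simp [Gphi, corePhi, BeforeB, tpos, tneg, eps] at hFB ht hv ⊢ <;>
    have hn : (0 : ℚ) ≤ n := n.cast_nonneg <;>
    have hk : (0 : ℚ) ≤ k := k.cast_nonneg <;>
    first
    | linarith
    | (rename_i i
       have h0 : (0 : ℚ) ≤ i := Nat.cast_nonneg _
       have h1 : (i : ℚ) + 1 ≤ n := by exact_mod_cast i.2
       rcases ht with rfl | rfl <;> linarith)
    | (rcases ht with rfl | rfl <;> linarith)

/-- Claim 1: every temporal spanner of `G_φ` contains both edges `BT`
and `BF` in its footprint. -/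
theorem stmt13 (n k : ℕ) (φ : Fin k → Fin n → Option Bool)
    (H : TemporalGraph (Vphi n k)) (hsp : H.IsSpanner (Gphi n k φ)) :
    H.footprint.Adj Vphi.B Vphi.T ∧ H.footprint.Adj Vphi.B Vphi.F := by
  obtain ⟨hsub, hconn⟩ := hsp
  constructor
  · by_contra hBT
    obtain ⟨_, h⟩ := (hconn .B .T (by simp)).exists_of_backward_invariant (P := BeforeT n k)
      (fun _ => trivial) fun u v s t ht => beforeT_of_contact
        (by rintro ⟨rfl, rfl⟩; exact hBT ⟨t, ht⟩) (hsub u v ht)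
    exact h
  · by_contra hBF
    obtain ⟨_, h⟩ := (hconn .F .B (by simp)).exists_of_backward_invariant (P := BeforeB n k)
      (fun _ => trivial) fun u v s t ht => beforeB_of_contact
        (by rintro ⟨rfl, rfl⟩; exact hBF ⟨t, H.symm .F .B ▸ ht⟩) (hsub u v ht)
    exact h

end TemporalPaper
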